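/- Proposition 2.4 (trivial estimate for the gain piece D^k_+). There exists a constant C > 0, depending only on n, s, γ, C_Φ and c_b, such that for every kernel b satisfying the standing kernel assumptions, every measurable g satisfying Assumption U with constant C_g > 0, all measurable f, h : ℝⁿ → ℝ, every k ∈ ℤ, and every measurable χ : ℝ → [0,1] vanishing outside the interval [2^{-k-1}, 2^{-k}], one has ∫∫∫ B(v-v_*,σ) χ(|v'-v|) |g(v_*)| |f(v) h(v')| dσ dv_* dv ≤ C · C_g · 2^{2sk} · |f|_{L²_{γ+2s}} |h|_{L²_{γ+2s}}, as an inequality of values in [0,∞]. -/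

import Mathlib

open MeasureTheory Real Set Metric
open scoped ENNReal RealInnerProductSpace

noncomputable section

/-- `ℝⁿ` with the Euclidean structure. -/
abbrev V (n : ℕ) := EuclideanSpace ℝ (Fin n)

/-- the Japanese bracket `⟨v⟩ = √(1+|v|²)`. -/
def jap {n : ℕ} (v : V n) : ℝ := Real.sqrt (1 + ‖v‖ ^ 2)

/-- the post-collisional velocity `v' = (v+v_*)/2 + (|v-v_*|/2)σ`. -/
def vprime {n : ℕ} (v vs σ : V n) : V n :=
  (2:ℝ)⁻¹ • (v + vs) + (‖v - vs‖ / 2) • σ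

/-- the anisotropic metric `d(v,v') = √(|v-v'|² + ¼(|v|²-|v'|²)²)` on the lifted paraboloid. -/
def anisoDist {n : ℕ} (v v' : V n) : ℝ :=
  Real.sqrt (‖v - v'‖ ^ 2 + 4⁻¹ * (‖v‖ ^ 2 - ‖v'‖ ^ 2) ^ 2)

/-- The standing assumptions on the angular kernel `b`: measurability, nonnegativity,
vanishing for deviation angles `θ ∈ (π/2, π]`, and the two-sided power bound
`c_b θ^{-(1+2s)} ≤ sin^{n-2}θ · b(cos θ) ≤ c_b⁻¹ θ^{-(1+2s)}` on `(0, π/2]`. -/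
def KernelAssumptions (n : ℕ) (s cb : ℝ) (b : ℝ → ℝ) : Prop :=
  Measurable b ∧ (∀ t : ℝ, 0 ≤ b t) ∧
  (∀ θ : ℝ, θ ∈ Set.Ioc (π / 2) π → b (Real.cos θ) = 0) ∧
  (∀ θ : ℝ, θ ∈ Set.Ioc 0 (π / 2) →
    cb * θ ^ (-(1 + 2 * s)) ≤ Real.sin θ ^ ((n : ℝ) - 2) * b (Real.cos θ) ∧
    Real.sin θ ^ ((n : ℝ) - 2) * b (Real.cos θ) ≤ cb⁻¹ * θ ^ (-(1 + 2 * s)))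

/-- The Boltzmann collision kernel `B(v-v_*,σ) = C_Φ |v-v_*|^γ b(⟨(v-v_*)/|v-v_*|, σ⟩)`. -/
def Bker {n : ℕ} (CΦ γ : ℝ) (b : ℝ → ℝ) (v vs σ : V n) : ℝ :=
  CΦ * ‖v - vs‖ ^ γ * b ⟪‖v - vs‖⁻¹ • (v - vs), σ⟫

/-- the surface measure on the unit sphere `S^{n-1}`. -/
def sphMeas (n : ℕ) : Measure (Metric.sphere (0 : V n) 1) :=
  (volume : Measure (V n)).toSphere

/-- the weighted squared `L²` norm `|f|²_{L²_ℓ}`, as a value in `[0,∞]`. -/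
def L2e {n : ℕ} (ℓ : ℝ) (f : V n → ℝ) : ℝ≥0∞ :=
  ∫⁻ v : V n, ENNReal.ofReal (jap v ^ ℓ * f v ^ 2)

/-- Assumption U: with `i = 1` for `s ∈ (0,1/2)` and `i = 2` for `s ∈ [1/2,1)`,
`∫ |v-v_*|^a ⟨v_*⟩^i |g(v_*)| dv_* ≤ C_g ⟨v⟩^a` for all `v` and all `a ∈ [γ, γ+2s]`. -/
def AssumptionU {n : ℕ} (s γ Cg : ℝ) (g : V n → ℝ) : Prop :=
  ∀ v : V n, ∀ a ∈ Set.Icc γ (γ + 2 * s),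
    (∫⁻ vs : V n, ENNReal.ofReal
        (‖v - vs‖ ^ a * jap vs ^ (if s < 2⁻¹ then (1:ℝ) else 2) * |g vs|)) ≤
      ENNReal.ofReal (Cg * jap v ^ a)


open scoped Pointwise in
/-- measure of a spherical cap -/
lemma cap_unit (n : ℕ) (hn : 2 ≤ n) (e : V n) (he : ‖e‖ = 1) (ρ : ℝ) (hρ : 0 ≤ ρ) :
    sphMeas n {σ | ‖(σ : V n) - e‖ ≤ ρ} ≤ ENNReal.ofReal (n * (2 * (2 * ρ) ^ (n - 1))) := by
  have i0 : Fin n := ⟨0, by omega⟩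
  have hort : Orthonormal ℝ (({i0} : Set (Fin n)).domRestrict (fun _ => e)) := by
    constructor
    · intro i; simpa using he
    · intro i j hij
      exact absurd (Subsingleton.elim i j) hij
  obtain ⟨B, hB⟩ := hort.exists_orthonormalBasis_extension_of_card_eq (by simp)
  have hB0 : B i0 = e := hB i0 rfl
  have hms : MeasurableSet {σ : Metric.sphere (0 : V n) 1 | ‖(σ : V n) - e‖ ≤ ρ} := by
    apply IsClosed.measurableSet
    exact isClosed_le (by fun_prop) (by fun_prop)
  rw [sphMeas, Measure.toSphere_apply' _ hms]
  set box : Set (Fin n → ℝ) :=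
    Set.pi Set.univ (fun i => if i = i0 then Set.Icc (-1) 1 else Set.Icc (-ρ) ρ) with hbox
  have hboxm : MeasurableSet box := by
    apply MeasurableSet.univ_pi
    intro i
    split_ifs <;> exact measurableSet_Icc
  have hsub : (Set.Ioo (0:ℝ) 1 • ((Subtype.val : Metric.sphere (0 : V n) 1 → V n) '' {σ : Metric.sphere (0 : V n) 1 | ‖(σ : V n) - e‖ ≤ ρ}))
      ⊆ (fun x => WithLp.ofLp (B.repr x)) ⁻¹' box := by
    rintro x ⟨t, ht, y, ⟨σ, hσ, rfl⟩, rfl⟩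
    simp only [hbox, Set.mem_preimage, Set.mem_pi, Set.mem_univ, forall_true_left]
    have hσ1 : ‖(σ : V n)‖ = 1 := by simpa using σ.2
    have key : ∀ i, ∀ z : V n, |⟪B i, z⟫| ≤ ‖z‖ := by
      intro i z
      have := abs_real_inner_le_norm (B i) z
      simpa using this
    intro i
    have hr : (B.repr (t • (σ : V n))) i = t * ⟪B i, (σ : V n)⟫ := by
      rw [OrthonormalBasis.repr_apply_apply, real_inner_smul_right]
    simp only [hr]
    have ht0 := ht.1
    have ht1 := ht.2
    split_ifs with h
    · rw [Set.mem_Icc, ← abs_le, abs_mul, abs_of_pos ht0]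
      have h1 := key i (σ : V n)
      rw [hσ1] at h1
      nlinarith [abs_nonneg ⟪B i, (σ : V n)⟫]
    · have h2 : ⟪B i, (σ : V n)⟫ = ⟪B i, (σ : V n) - e⟫ := by
        rw [inner_sub_right, ← hB0, B.orthonormal.2 h, sub_zero]
      rw [Set.mem_Icc, ← abs_le, abs_mul, abs_of_pos ht0, h2]
      have h1 := key i ((σ : V n) - e)
      have h3 : ‖(σ : V n) - e‖ ≤ ρ := hσ
      nlinarith [abs_nonneg ⟪B i, (σ : V n) - e⟫]
  have hvol : volume ((fun x => WithLp.ofLp (B.repr x)) ⁻¹' box) = volume box := by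
    have h1 := (PiLp.volume_preserving_ofLp (Fin n)).comp B.measurePreserving_repr
    exact h1.measure_preimage hboxm.nullMeasurableSet
  have hvb : volume box = ENNReal.ofReal (2 * (2 * ρ) ^ (n - 1)) := by
    rw [hbox, volume_pi_pi, ← Finset.mul_prod_erase _ _ (Finset.mem_univ i0)]
    rw [Finset.prod_congr rfl (g := fun _ => ENNReal.ofReal (2 * ρ))]
    · rw [Finset.prod_const, ENNReal.ofReal_mul (p := 2) (q := (2 * ρ) ^ (n - 1)) (by norm_num),
        ENNReal.ofReal_pow (by positivity)]
      simp
      norm_num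
    · intro i hi
      rw [if_neg (Finset.ne_of_mem_erase hi), Real.volume_Icc]
      congr 1; ring
  calc _ ≤ (n : ℝ≥0∞) * volume box := by
        rw [← hvol]
        simp only [finrank_euclideanSpace, Fintype.card_fin]
        gcongr
    _ = _ := by
        rw [hvb, ENNReal.ofReal_mul (by positivity)]
        simp

lemma cap_meas (n : ℕ) (hn : 2 ≤ n) (w : V n) (hw : w ≠ 0) (δ : ℝ) (hδ : 0 < δ) :
    sphMeas n {σ | ‖‖w‖ • (σ : V n) - w‖ ≤ 2 * δ} ≤
      ENNReal.ofReal ((n * (2 * 4 ^ ((n:ℝ) - 1))) * (δ ^ ((n:ℝ) - 1) * ‖w‖ ^ (-((n:ℝ) - 1)))) := by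
  have hw0 : 0 < ‖w‖ := norm_pos_iff.2 hw
  have h1 := cap_unit n hn (‖w‖⁻¹ • w) (by rw [norm_smul]; simp [hw0.ne']) (2 * δ / ‖w‖) (by positivity)
  have hset : {σ : Metric.sphere (0 : V n) 1 | ‖‖w‖ • (σ : V n) - w‖ ≤ 2 * δ} =
      {σ : Metric.sphere (0 : V n) 1 | ‖(σ : V n) - ‖w‖⁻¹ • w‖ ≤ 2 * δ / ‖w‖} := by
    ext σ
    have : ‖w‖ • (σ : V n) - w = ‖w‖ • ((σ : V n) - ‖w‖⁻¹ • w) := by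
      rw [smul_sub, smul_smul, mul_inv_cancel₀ hw0.ne', one_smul]
    simp only [Set.mem_ofPred_eq]
    rw [this, norm_smul, norm_norm, le_div_iff₀ hw0, mul_comm]
  rw [hset]
  refine h1.trans (le_of_eq ?_)
  congr 1
  have hc : ((n - 1 : ℕ) : ℝ) = (n : ℝ) - 1 := by
    push_cast [Nat.cast_sub (show 1 ≤ n by omega)]; ring
  rw [← Real.rpow_natCast, hc, show 2 * (2 * δ / ‖w‖) = 4 * (δ * ‖w‖⁻¹) by field_simp; ring,
    Real.mul_rpow (by norm_num) (by positivity), Real.mul_rpow (by positivity) (by positivity),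
    Real.inv_rpow (by positivity), Real.rpow_neg (by positivity)]
  ring

def Tm {n : ℕ} (σ u : V n) : V n := (2:ℝ)⁻¹ • u + (‖u‖ / 2) • σ

lemma Tm_inner {n : ℕ} (σ u : V n) (hσ : ‖σ‖ = 1) : ⟪Tm σ u, σ⟫ = (⟪u, σ⟫ + ‖u‖) / 2 := by
  rw [Tm, inner_add_left, real_inner_smul_left, real_inner_smul_left, real_inner_self_eq_norm_sq, hσ]
  ring

lemma Tm_norm_sq {n : ℕ} (σ u : V n) (hσ : ‖σ‖ = 1) :
    ‖Tm σ u‖ ^ 2 = ‖u‖ * (⟪u, σ⟫ + ‖u‖) / 2 := by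
  rw [Tm, norm_add_sq_real, norm_smul, norm_smul, real_inner_smul_left, real_inner_smul_right, hσ]
  simp only [norm_inv, Real.norm_ofNat, norm_div, norm_norm]
  ring

def cone {n : ℕ} (σ : V n) : Set (V n) := {u | u ≠ 0 ∧ 0 ≤ ⟪u, σ⟫}

lemma cone_meas {n : ℕ} (σ : V n) : MeasurableSet (cone σ) := by
  have : cone σ = {0}ᶜ ∩ {u | 0 ≤ ⟪u, σ⟫} := by ext; simp [cone]
  rw [this]
  exact (measurableSet_singleton _).compl.inter
    (isClosed_le (by fun_prop) (by fun_prop)).measurableSet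

lemma Tm_inj {n : ℕ} (σ : V n) (hσ : ‖σ‖ = 1) : Set.InjOn (Tm σ) (cone σ) := by
  have key : ∀ u ∈ cone σ, ‖u‖ = ‖Tm σ u‖ ^ 2 / ⟪Tm σ u, σ⟫ := by
    intro u hu
    have h0 : 0 < ‖u‖ := norm_pos_iff.2 hu.1
    have h1 : 0 < ⟪u, σ⟫ + ‖u‖ := by linarith [hu.2]
    rw [Tm_norm_sq _ _ hσ, Tm_inner _ _ hσ]
    field_simp
  intro u hu v hv h
  have hn : ‖u‖ = ‖v‖ := by rw [key u hu, key v hv, h]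
  simp only [Tm, hn] at h
  have := add_right_cancel h
  exact smul_right_injective _ (by norm_num : (2:ℝ)⁻¹ ≠ 0) this

def Td {n : ℕ} (σ u : V n) : V n →L[ℝ] V n :=
  (2:ℝ)⁻¹ • (ContinuousLinearMap.id ℝ (V n) + (‖u‖⁻¹ • innerSL ℝ u).smulRight σ)

lemma Tm_deriv {n : ℕ} (σ u : V n) (hu : u ≠ 0) : HasFDerivAt (Tm σ) (Td σ u) u := by
  have h0 : 0 < ‖u‖ := norm_pos_iff.2 hu
  have h1 := (hasFDerivAt_id (𝕜 := ℝ) u).norm_sq.sqrt (by simpa using hu)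
  have h2 : HasFDerivAt (fun x : V n => ‖x‖) (‖u‖⁻¹ • innerSL ℝ u) u := by
    have e1 : (fun x : V n => ‖x‖) = fun y => √(‖id y‖ ^ 2) := by ext x; simp
    have e2 : (‖u‖⁻¹ • innerSL ℝ u : V n →L[ℝ] ℝ) = (1 / (2 * √(‖id u‖ ^ 2))) •
        2 • (innerSL ℝ) (id u) ∘SL ContinuousLinearMap.id ℝ (V n) := by
      ext x
      simp
      field_simp
    rw [e1, e2]
    exact h1
  have h3 := ((hasFDerivAt_id (𝕜 := ℝ) u).const_smul (2:ℝ)⁻¹).add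
    ((h2.const_mul (2:ℝ)⁻¹).smul_const σ)
  have e1 : Tm σ = (2:ℝ)⁻¹ • id + fun y : V n => (2⁻¹ * ‖y‖) • σ := by
    ext x i
    simp only [Tm, PiLp.add_apply, PiLp.smul_apply, smul_eq_mul, Pi.add_apply, Pi.smul_apply, id]
    ring
  have e2 : Td σ u = (2:ℝ)⁻¹ • ContinuousLinearMap.id ℝ (V n) +
      ((2:ℝ)⁻¹ • ‖u‖⁻¹ • (innerSL ℝ) u : V n →L[ℝ] ℝ).smulRight σ := by
    ext x i
    simp [Td]; ring
  rw [e1, e2]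
  exact h3

lemma Td_det {n : ℕ} (σ u : V n) : (Td σ u).det = (2:ℝ)⁻¹ ^ n * (1 + ‖u‖⁻¹ * ⟪u, σ⟫) := by
  have : ((Td σ u : V n →L[ℝ] V n) : V n →ₗ[ℝ] V n) =
      (2:ℝ)⁻¹ • LinearMap.transvection ((‖u‖⁻¹ • innerSL ℝ u : V n →L[ℝ] ℝ) : V n →ₗ[ℝ] ℝ) σ := by
    ext x i
    simp [Td, LinearMap.transvection]
  rw [ContinuousLinearMap.det, this, LinearMap.det_smul, LinearMap.transvection.det]
  simp

lemma chvar {n : ℕ} (σ : V n) (hσ : ‖σ‖ = 1) (G : V n → ℝ≥0∞) :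
    ∫⁻ u, (cone σ).indicator (fun u => G (Tm σ u)) u ≤ 2 ^ n * ∫⁻ w, G w := by
  rw [lintegral_indicator (cone_meas σ)]
  calc ∫⁻ u in cone σ, G (Tm σ u)
      ≤ ∫⁻ u in cone σ, 2 ^ n * (ENNReal.ofReal |(Td σ u).det| * G (Tm σ u)) := by
        apply setLIntegral_mono' (cone_meas σ)
        intro u hu
        rw [← mul_assoc]
        apply le_mul_of_one_le_left zero_le
        have : (2:ℝ≥0∞) ^ n = ENNReal.ofReal (2 ^ n) := by
          rw [ENNReal.ofReal_pow (by norm_num)]; simp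
        rw [this, ← ENNReal.ofReal_mul (by positivity), ENNReal.one_le_ofReal, Td_det]
        have h0 : 0 ≤ ‖u‖⁻¹ * ⟪u, σ⟫ := mul_nonneg (by positivity) hu.2
        rw [abs_of_nonneg (by positivity), ← mul_assoc, ← mul_pow]
        norm_num
        exact h0
    _ = 2 ^ n * ∫⁻ u in cone σ, (ENNReal.ofReal |(Td σ u).det| * G (Tm σ u)) := by
        rw [lintegral_const_mul' _ _ (by finiteness)]
    _ = 2 ^ n * ∫⁻ w in Tm σ '' cone σ, G w := by
        rw [lintegral_image_eq_lintegral_abs_det_fderiv_mul volume (cone_meas σ)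
          (fun u hu => (Tm_deriv σ u hu.1).hasFDerivWithinAt) (Tm_inj σ hσ)]
    _ ≤ _ := by
        gcongr
        exact Measure.restrict_le_self

lemma b_bound (n : ℕ) (hn : 2 ≤ n) (s cb : ℝ) (hs : 0 < s) (hcb : 0 < cb) (b : ℝ → ℝ)
    (hb : KernelAssumptions n s cb b) (t ρ : ℝ) (ht : -1 ≤ t) (hρ : 0 < ρ)
    (hρt : ρ ^ 2 = 2 - 2 * t) :
    b t ≤ cb⁻¹ * (π / 2) ^ ((n:ℝ) - 2) * ρ ^ (-((n:ℝ) - 1 + 2 * s)) := by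
  obtain ⟨-, hb0, hb1, hb2⟩ := hb
  have hpi := Real.pi_pos
  have hn' : (2:ℝ) ≤ n := by exact_mod_cast hn
  have ht1 : t < 1 := by nlinarith
  set θ := Real.arccos t with hθ
  have hcos : Real.cos θ = t := Real.cos_arccos ht ht1.le
  have hθ0 : 0 < θ := Real.arccos_pos.2 ht1
  have hθpi : θ ≤ π := Real.arccos_le_pi t
  by_cases h : π / 2 < θ
  · have := hb1 θ ⟨h, hθpi⟩
    rw [hcos] at this
    rw [this]; positivity
  · push Not at h
    have h2 := (hb2 θ ⟨hθ0, h⟩).2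
    rw [hcos] at h2
    have hsin := Real.mul_le_sin hθ0.le h
    have hρθ : ρ ≤ θ := by
      have := Real.one_sub_sq_div_two_le_cos (x := θ)
      rw [hcos] at this
      nlinarith
    have hm : (2 / π * θ) ^ ((n:ℝ) - 2) ≤ Real.sin θ ^ ((n:ℝ) - 2) :=
      Real.rpow_le_rpow (by positivity) hsin (by linarith)
    have h3 : (2 / π * θ) ^ ((n:ℝ) - 2) * b t ≤ cb⁻¹ * θ ^ (-(1 + 2 * s)) :=
      (mul_le_mul_of_nonneg_right hm (hb0 t)).trans h2
    rw [Real.mul_rpow (by positivity) hθ0.le] at h3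
    have e1 : (π / 2) ^ ((n:ℝ) - 2) * (2 / π) ^ ((n:ℝ) - 2) = 1 := by
      rw [← Real.mul_rpow (by positivity) (by positivity)]
      rw [show π / 2 * (2 / π) = 1 by field_simp, Real.one_rpow]
    have e2 : θ ^ (-((n:ℝ) - 2)) * θ ^ ((n:ℝ) - 2) = 1 := by
      rw [← Real.rpow_add hθ0]; simp
    have e3 : θ ^ (-((n:ℝ) - 2)) * θ ^ (-(1 + 2 * s)) = θ ^ (-((n:ℝ) - 1 + 2 * s)) := by
      rw [← Real.rpow_add hθ0]; ring_nf
    have h4 := mul_le_mul_of_nonneg_left h3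
      (show 0 ≤ (π / 2) ^ ((n:ℝ) - 2) * θ ^ (-((n:ℝ) - 2)) by positivity)
    calc b t = ((π / 2) ^ ((n:ℝ) - 2) * (2 / π) ^ ((n:ℝ) - 2)) *
          (θ ^ (-((n:ℝ) - 2)) * θ ^ ((n:ℝ) - 2)) * b t := by rw [e1, e2]; ring
      _ ≤ cb⁻¹ * (π / 2) ^ ((n:ℝ) - 2) * (θ ^ (-((n:ℝ) - 2)) * θ ^ (-(1 + 2 * s))) := by
          linarith
      _ ≤ _ := by
          rw [e3]
          gcongr cb⁻¹ * (π / 2) ^ ((n:ℝ) - 2) * ?_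
          exact Real.rpow_le_rpow_of_nonpos hρ hρθ (by linarith)

lemma b_zero (n : ℕ) (s cb : ℝ) (b : ℝ → ℝ)
    (hb : KernelAssumptions n s cb b) (t : ℝ) (ht : -1 ≤ t) (h0 : t < 0) : b t = 0 := by
  obtain ⟨-, -, hb1, -⟩ := hb
  have := hb1 (Real.arccos t) ⟨by
    rw [← not_le, Real.arccos_le_pi_div_two]; linarith, Real.arccos_le_pi t⟩
  rwa [Real.cos_arccos ht (by linarith)] at this

open Classical in
/-- the explicit majorant of the kernel -/
@[irreducible] def Mk {n : ℕ} (δ q : ℝ) (σ w : V n) : ℝ :=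
  if w ≠ 0 ∧ ‖‖w‖ • σ - w‖ ≤ 2 * δ then ‖w‖ ^ q else 0

open Classical in
/-- the majorant at the transported point, restricted to the cone -/
@[irreducible] def Mt {n : ℕ} (δ q : ℝ) (σ u : V n) : ℝ :=
  if u ∈ cone σ then Mk δ q σ (Tm σ u) else 0

lemma Mk_nonneg {n : ℕ} (δ q : ℝ) (σ w : V n) : 0 ≤ Mk δ q σ w := by
  unfold Mk; split_ifs <;> positivity

lemma Mt_nonneg {n : ℕ} (δ q : ℝ) (σ w : V n) : 0 ≤ Mt δ q σ w := by
  unfold Mt; split_ifs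
  · exact Mk_nonneg _ _ _ _
  · exact le_rfl

lemma Tm_meas {n : ℕ} : Measurable (fun x : V n × V n => Tm x.1 x.2) := by
  unfold Tm
  exact Continuous.measurable (by fun_prop)

lemma Mk_meas {n : ℕ} (δ q : ℝ) : Measurable (fun x : V n × V n => Mk δ q x.1 x.2) := by
  unfold Mk
  refine Measurable.ite ?_ (by fun_prop) measurable_const
  have h1 : MeasurableSet {x : V n × V n | x.2 ≠ 0} :=
    (isOpen_ne_fun (by fun_prop) (by fun_prop)).measurableSet
  have h2 : MeasurableSet {x : V n × V n | ‖‖x.2‖ • x.1 - x.2‖ ≤ 2 * δ} :=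
    (isClosed_le (by fun_prop) (by fun_prop)).measurableSet
  exact h1.inter h2

lemma Mt_meas {n : ℕ} (δ q : ℝ) : Measurable (fun x : V n × V n => Mt δ q x.1 x.2) := by
  unfold Mt
  refine Measurable.ite ?_ ((Mk_meas δ q).comp (measurable_fst.prodMk Tm_meas)) measurable_const
  have h1 : MeasurableSet {x : V n × V n | x.2 ≠ 0} :=
    (isOpen_ne_fun (by fun_prop) (by fun_prop)).measurableSet
  have h2 : MeasurableSet {x : V n × V n | 0 ≤ ⟪x.2, x.1⟫} :=
    (isClosed_le (by fun_prop) (by fun_prop)).measurableSet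
  exact h1.inter h2

lemma cone_rpow {n : ℕ} (δ q : ℝ) (σ u : V n) (hσ : ‖σ‖ = 1) (hu : u ∈ cone σ)
    (h : ‖‖u‖ • σ - u‖ ≤ 2 * δ) : ‖u‖ ^ q ≤ 2 ^ |q| * Mt δ q σ u := by
  have h0 : 0 < ‖u‖ := norm_pos_iff.2 hu.1
  have hc := hu.2
  have hcx : ⟪u, σ⟫ ≤ ‖u‖ := by
    have := real_inner_le_norm u σ
    rwa [hσ, mul_one] at this
  have hw2 := Tm_norm_sq σ u hσ
  have hwi := Tm_inner σ u hσ
  set w := Tm σ u with hw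
  have hwi2 : ⟪w, σ⟫ ≤ ‖w‖ := by
    have := real_inner_le_norm w σ
    rwa [hσ, mul_one] at this
  have hw0 : 0 < ‖w‖ := by linarith
  have hle : ‖w‖ ≤ ‖u‖ := by nlinarith
  have hle2 : ‖u‖ ≤ 2 * ‖w‖ := by nlinarith
  have hs1 : ‖‖w‖ • σ - w‖ ^ 2 = 2 * ‖w‖ ^ 2 - 2 * ‖w‖ * ⟪w, σ⟫ := by
    rw [norm_sub_sq_real, norm_smul, hσ, real_inner_smul_left, norm_norm, real_inner_comm]; ring
  have hs2 : ‖‖u‖ • σ - u‖ ^ 2 = 2 * ‖u‖ ^ 2 - 2 * ‖u‖ * ⟪u, σ⟫ := by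
    rw [norm_sub_sq_real, norm_smul, hσ, real_inner_smul_left, norm_norm, real_inner_comm]; ring
  have hle3 : ‖‖w‖ • σ - w‖ ≤ ‖‖u‖ • σ - u‖ := by
    apply le_of_sq_le_sq _ (norm_nonneg _)
    rw [hs1, hs2]
    have a1 : ‖w‖ * ⟪w, σ⟫ ≥ ⟪w, σ⟫ ^ 2 := by nlinarith
    rw [hwi] at a1 ⊢
    nlinarith [mul_nonneg h0.le (sub_nonneg.2 hcx), mul_nonneg hc (sub_nonneg.2 hcx)]
  have hwne : w ≠ 0 := norm_pos_iff.1 hw0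
  have : Mt δ q σ u = ‖w‖ ^ q := by
    rw [Mt, if_pos hu, Mk, if_pos ⟨hwne, hle3.trans h⟩]
  rw [this]
  rcases le_or_gt 0 q with hq | hq
  · rw [abs_of_nonneg hq, ← Real.mul_rpow (by norm_num) hw0.le]
    exact Real.rpow_le_rpow h0.le hle2 hq
  · calc ‖u‖ ^ q ≤ ‖w‖ ^ q := Real.rpow_le_rpow_of_nonpos hw0 hle hq.le
      _ ≤ _ := by
        apply le_mul_of_one_le_left (by positivity)
        exact Real.one_le_rpow (by norm_num) (abs_nonneg q)

/-- constant for the pointwise bound -/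
def K2 (n : ℕ) (s γ CΦ cb : ℝ) : ℝ :=
  CΦ * (cb⁻¹ * (π / 2) ^ ((n:ℝ) - 2)) * 2 ^ |γ + ((n:ℝ) - 1 + 2 * s)|

lemma pointwise (n : ℕ) (hn : 2 ≤ n) (s γ CΦ cb : ℝ) (hs : 0 < s) (hCΦ : 0 < CΦ) (hcb : 0 < cb)
    (b : ℝ → ℝ) (hb : KernelAssumptions n s cb b) (δ : ℝ) (hδ : 0 < δ) (χ : ℝ → ℝ)
    (hχ : ∀ t, χ t ∈ Set.Icc (0:ℝ) 1) (hχ0 : ∀ t, t ∉ Set.Icc (δ / 2) δ → χ t = 0)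
    (v vs σ : V n) (hσ : ‖σ‖ = 1) :
    Bker CΦ γ b v vs σ * χ ‖vprime v vs σ - v‖ ≤
      K2 n s γ CΦ cb * δ ^ (-((n:ℝ) - 1 + 2 * s)) * Mk δ (γ + ((n:ℝ) - 1 + 2 * s)) σ (v - vs) ∧
    Bker CΦ γ b v vs σ * χ ‖vprime v vs σ - v‖ ≤
      K2 n s γ CΦ cb * δ ^ (-((n:ℝ) - 1 + 2 * s)) * Mt δ (γ + ((n:ℝ) - 1 + 2 * s)) σ (v - vs) := by
  have hpi := Real.pi_pos
  have hn' : (2:ℝ) ≤ n := by exact_mod_cast hn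
  set p := (n:ℝ) - 1 + 2 * s with hp
  have hp0 : 0 < p := by rw [hp]; linarith
  have hK2 : 0 < K2 n s γ CΦ cb := by unfold K2; positivity
  have hr1 : 0 ≤ K2 n s γ CΦ cb * δ ^ (-p) * Mk δ (γ + p) σ (v - vs) :=
    mul_nonneg (by positivity) (Mk_nonneg _ _ _ _)
  have hr2 : 0 ≤ K2 n s γ CΦ cb * δ ^ (-p) * Mt δ (γ + p) σ (v - vs) :=
    mul_nonneg (by positivity) (Mt_nonneg _ _ _ _)
  have hvp : vprime v vs σ - v = (2:ℝ)⁻¹ • (‖v - vs‖ • σ - (v - vs)) := by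
    unfold vprime; ext i; simp; ring
  by_cases hmem : ‖vprime v vs σ - v‖ ∈ Set.Icc (δ / 2) δ
  swap
  · rw [hχ0 _ hmem, mul_zero]; exact ⟨hr1, hr2⟩
  rw [hvp, norm_smul] at hmem
  simp only [norm_inv, Real.norm_ofNat, Set.mem_Icc] at hmem
  have hchi := hχ ‖vprime v vs σ - v‖
  unfold Bker
  set u := v - vs with hu
  set R := ‖‖u‖ • σ - u‖ with hR
  have hR1 : δ ≤ R := by linarith [hmem.1]
  have hR2 : R ≤ 2 * δ := by linarith [hmem.2]
  have hu0 : u ≠ 0 := by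
    intro h
    rw [h] at hR
    simp at hR
    linarith
  have hx : 0 < ‖u‖ := norm_pos_iff.2 hu0
  have hcx : |⟪u, σ⟫| ≤ ‖u‖ := by
    have := abs_real_inner_le_norm u σ
    rwa [hσ, mul_one] at this
  have hti : ⟪‖u‖⁻¹ • u, σ⟫ = ⟪u, σ⟫ / ‖u‖ := by
    rw [real_inner_smul_left]; ring
  have ht : -1 ≤ ⟪‖u‖⁻¹ • u, σ⟫ := by
    rw [hti, le_div_iff₀ hx]; linarith [(abs_le.1 hcx).1]
  by_cases hc : ⟪u, σ⟫ < 0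
  · have : b ⟪‖u‖⁻¹ • u, σ⟫ = 0 := b_zero n s cb b hb _ ht (by
      rw [hti]; exact div_neg_of_neg_of_pos hc hx)
    rw [this]; simp only [mul_zero, zero_mul]; exact ⟨hr1, hr2⟩
  push Not at hc
  have hR0 : R ^ 2 = 2 * ‖u‖ ^ 2 - 2 * ‖u‖ * ⟪u, σ⟫ := by
    rw [hR, norm_sub_sq_real, norm_smul, hσ, real_inner_smul_left, norm_norm, real_inner_comm]; ring
  have hbb := b_bound n hn s cb hs hcb b hb _ (R / ‖u‖) ht (div_pos (by linarith) hx) (by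
    rw [div_pow, hR0, hti]; field_simp)
  have hRδ : (R / ‖u‖) ^ (-p) ≤ δ ^ (-p) * ‖u‖ ^ p := by
    calc (R / ‖u‖) ^ (-p) ≤ (δ / ‖u‖) ^ (-p) :=
          Real.rpow_le_rpow_of_nonpos (by positivity) (by gcongr) (by linarith)
      _ = _ := by
        rw [Real.div_rpow hδ.le hx.le, Real.rpow_neg hx.le]; field_simp
  have hb0 : 0 ≤ b ⟪‖u‖⁻¹ • u, σ⟫ := hb.2.1 _
  have hmain : CΦ * ‖u‖ ^ γ * b ⟪‖u‖⁻¹ • u, σ⟫ * χ ‖vprime v vs σ - v‖ ≤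
      CΦ * (cb⁻¹ * (π / 2) ^ ((n:ℝ) - 2)) * δ ^ (-p) * ‖u‖ ^ (γ + p) := by
    calc _ ≤ CΦ * ‖u‖ ^ γ * b ⟪‖u‖⁻¹ • u, σ⟫ :=
          mul_le_of_le_one_right (by positivity) hchi.2
      _ ≤ CΦ * ‖u‖ ^ γ * (cb⁻¹ * (π / 2) ^ ((n:ℝ) - 2) * (δ ^ (-p) * ‖u‖ ^ p)) := by
          gcongr
          exact hbb.trans (by gcongr)
      _ = _ := by rw [Real.rpow_add hx γ p]; ring
  have hMk : Mk δ (γ + p) σ u = ‖u‖ ^ (γ + p) := by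
    rw [Mk, if_pos ⟨hu0, hR2⟩]
  have hMt := cone_rpow δ (γ + p) σ u hσ ⟨hu0, hc⟩ hR2
  have h21 : (1:ℝ) ≤ 2 ^ |γ + p| := Real.one_le_rpow (by norm_num) (abs_nonneg _)
  constructor
  · refine hmain.trans ?_
    rw [hMk, K2, ← hp]
    have h5 : 0 ≤ CΦ * (cb⁻¹ * (π / 2) ^ ((n:ℝ) - 2)) * δ ^ (-p) * ‖u‖ ^ (γ + p) := by positivity
    calc _ ≤ CΦ * (cb⁻¹ * (π / 2) ^ ((n:ℝ) - 2)) * δ ^ (-p) * ‖u‖ ^ (γ + p) * 2 ^ |γ + p| :=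
          le_mul_of_one_le_right h5 h21
      _ = _ := by ring
  · refine hmain.trans ?_
    rw [K2, ← hp]
    calc _ ≤ CΦ * (cb⁻¹ * (π / 2) ^ ((n:ℝ) - 2)) * δ ^ (-p) * (2 ^ |γ + p| * Mt δ (γ + p) σ u) := by
          gcongr
      _ = _ := by ring

instance (n : ℕ) : SFinite (sphMeas n) := by unfold sphMeas; infer_instance

def Cn (n : ℕ) : ℝ := n * (2 * 4 ^ ((n:ℝ) - 1))

lemma Mk_int (n : ℕ) (hn : 2 ≤ n) (δ a : ℝ) (hδ : 0 < δ) (w : V n) :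
    ∫⁻ σ : Metric.sphere (0 : V n) 1, ENNReal.ofReal (Mk δ (a + ((n:ℝ) - 1)) (σ : V n) w) ∂(sphMeas n)
      ≤ ENNReal.ofReal (Cn n * δ ^ ((n:ℝ) - 1) * ‖w‖ ^ a) := by
  by_cases hw : w = 0
  · simp [Mk, hw]
  have hw0 : 0 < ‖w‖ := norm_pos_iff.2 hw
  have hms : MeasurableSet {σ : Metric.sphere (0 : V n) 1 | ‖‖w‖ • (σ : V n) - w‖ ≤ 2 * δ} :=
    (isClosed_le (by fun_prop) (by fun_prop)).measurableSet
  have heq : ∀ σ : Metric.sphere (0 : V n) 1,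
      ENNReal.ofReal (Mk δ (a + ((n:ℝ) - 1)) (σ : V n) w) =
      {σ : Metric.sphere (0 : V n) 1 | ‖‖w‖ • (σ : V n) - w‖ ≤ 2 * δ}.indicator
        (fun _ => ENNReal.ofReal (‖w‖ ^ (a + ((n:ℝ) - 1)))) σ := by
    intro σ
    by_cases h : ‖‖w‖ • (σ : V n) - w‖ ≤ 2 * δ
    · rw [Set.indicator_of_mem (show σ ∈ {σ : Metric.sphere (0 : V n) 1 | ‖‖w‖ • (σ : V n) - w‖ ≤ 2 * δ} from h), Mk,
        if_pos ⟨hw, h⟩]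
    · rw [Set.indicator_of_notMem (show σ ∉ {σ : Metric.sphere (0 : V n) 1 | ‖‖w‖ • (σ : V n) - w‖ ≤ 2 * δ} from h), Mk,
        if_neg (fun h' => h h'.2), ENNReal.ofReal_zero]
  simp_rw [heq]
  rw [lintegral_indicator hms, setLIntegral_const]
  calc _ ≤ ENNReal.ofReal (‖w‖ ^ (a + ((n:ℝ) - 1))) *
        ENNReal.ofReal (Cn n * (δ ^ ((n:ℝ) - 1) * ‖w‖ ^ (-((n:ℝ) - 1)))) := by
        gcongr
        exact cap_meas n hn w hw δ hδ
    _ = _ := by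
        rw [← ENNReal.ofReal_mul (by positivity)]
        congr 1
        have : ‖w‖ ^ (a + ((n:ℝ) - 1)) * ‖w‖ ^ (-((n:ℝ) - 1)) = ‖w‖ ^ a := by
          rw [← Real.rpow_add hw0]; ring_nf
        rw [← this]; ring

lemma jap_one_le {n : ℕ} (v : V n) : 1 ≤ jap v := by
  unfold jap
  rw [Real.one_le_sqrt]
  nlinarith [sq_nonneg ‖v‖]

lemma fpart (n : ℕ) (hn : 2 ≤ n) (s γ : ℝ) (hs : 0 < s) (δ : ℝ) (hδ : 0 < δ)
    (g : V n → ℝ) (Cg : ℝ) (hCg : 0 < Cg) (hU : AssumptionU s γ Cg g)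
    (f : V n → ℝ) :
    ∫⁻ v : V n, ∫⁻ vs : V n, ∫⁻ σ : Metric.sphere (0 : V n) 1,
      ENNReal.ofReal (Mk δ (γ + ((n:ℝ) - 1 + 2 * s)) (σ : V n) (v - vs) * |g vs| * f v ^ 2) ∂(sphMeas n)
    ≤ ENNReal.ofReal (Cn n * δ ^ ((n:ℝ) - 1) * Cg) * L2e (γ + 2 * s) f := by
  have hCn : 0 ≤ Cn n := by unfold Cn; positivity
  rw [L2e, ← lintegral_const_mul' _ _ (by finiteness)]
  apply lintegral_mono
  intro v
  have hi : ∀ vs : V n, ∫⁻ σ : Metric.sphere (0 : V n) 1,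
      ENNReal.ofReal (Mk δ (γ + ((n:ℝ) - 1 + 2 * s)) (σ : V n) (v - vs) * |g vs| * f v ^ 2) ∂(sphMeas n)
      ≤ ENNReal.ofReal (Cn n * δ ^ ((n:ℝ) - 1) * f v ^ 2) * ENNReal.ofReal
        (‖v - vs‖ ^ (γ + 2 * s) * jap vs ^ (if s < 2⁻¹ then (1:ℝ) else 2) * |g vs|) := by
    intro vs
    have h1 := Mk_int n hn δ (γ + 2 * s) hδ (v - vs)
    rw [show γ + 2 * s + ((n:ℝ) - 1) = γ + ((n:ℝ) - 1 + 2 * s) by ring] at h1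
    simp_rw [mul_assoc (Mk _ _ _ _), ENNReal.ofReal_mul (Mk_nonneg _ _ _ _)]
    rw [lintegral_mul_const' _ _ (by finiteness)]
    refine (mul_le_mul_left h1 _).trans ?_
    rw [← ENNReal.ofReal_mul (by positivity), ← ENNReal.ofReal_mul (by positivity)]
    apply ENNReal.ofReal_le_ofReal
    have hj : 1 ≤ jap vs ^ (if s < 2⁻¹ then (1:ℝ) else 2) :=
      Real.one_le_rpow (jap_one_le vs) (by split_ifs <;> norm_num)
    calc _ = (Cn n * δ ^ ((n:ℝ) - 1) * f v ^ 2) * (‖v - vs‖ ^ (γ + 2 * s) * 1 * |g vs|) := by ring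
      _ ≤ _ := by gcongr
  refine (lintegral_mono hi).trans ?_
  rw [lintegral_const_mul' _ _ (by finiteness)]
  refine (mul_le_mul_right (hU v (γ + 2 * s) ⟨by linarith, le_rfl⟩) _).trans ?_
  simp only
  rw [← ENNReal.ofReal_mul (by positivity), ← ENNReal.ofReal_mul (by positivity)]
  apply le_of_eq
  congr 1
  ring

lemma swap3 (n : ℕ) (F : V n → V n → Metric.sphere (0 : V n) 1 → ℝ≥0∞)
    (hF : Measurable (fun x : V n × V n × Metric.sphere (0 : V n) 1 => F x.1 x.2.1 x.2.2)) :
    ∫⁻ v : V n, ∫⁻ vs : V n, ∫⁻ σ, F v vs σ ∂(sphMeas n) =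
    ∫⁻ vs : V n, ∫⁻ σ, (∫⁻ v : V n, F v vs σ) ∂(sphMeas n) := by
  have h1 : ∀ v : V n, ∫⁻ vs : V n, ∫⁻ σ, F v vs σ ∂(sphMeas n) =
      ∫⁻ y, F v y.1 y.2 ∂((volume : Measure (V n)).prod (sphMeas n)) := by
    intro v
    rw [lintegral_prod (fun y : V n × Metric.sphere (0 : V n) 1 => F v y.1 y.2)]
    exact (hF.comp (measurable_const.prodMk measurable_id)).aemeasurable
  simp_rw [h1]
  rw [lintegral_lintegral_swap (f := fun (v : V n) (y : V n × Metric.sphere (0 : V n) 1) => F v y.1 y.2) hF.aemeasurable]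
  rw [lintegral_prod (fun y : V n × Metric.sphere (0 : V n) 1 => ∫⁻ v : V n, F v y.1 y.2)]
  exact (Measurable.lintegral_prod_left' hF).aemeasurable

lemma vprime_eq {n : ℕ} (v vs σ : V n) : vprime v vs σ = vs + Tm σ (v - vs) := by
  unfold vprime Tm; ext i; simp; ring

lemma vprime_meas (n : ℕ) : Measurable
    (fun x : V n × V n × Metric.sphere (0 : V n) 1 => vprime x.1 x.2.1 (x.2.2 : V n)) := by
  unfold vprime
  exact Continuous.measurable (by fun_prop)

lemma A_meas (n : ℕ) (δ q : ℝ) (g f : V n → ℝ) (hg : Measurable g) (hf : Measurable f) :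
    Measurable (fun x : V n × V n × Metric.sphere (0 : V n) 1 =>
      ENNReal.ofReal (Mk δ q (x.2.2 : V n) (x.1 - x.2.1) * |g x.2.1| * f x.1 ^ 2)) := by
  have h1 : Measurable (fun x : V n × V n × Metric.sphere (0 : V n) 1 =>
      Mk δ q (x.2.2 : V n) (x.1 - x.2.1)) :=
    (Mk_meas δ q).comp (Measurable.prodMk (by fun_prop) (by fun_prop))
  have h2 : Measurable (fun x : V n × V n × Metric.sphere (0 : V n) 1 => |g x.2.1|) := by
    simp_rw [← Real.norm_eq_abs]; fun_prop
  exact ((h1.mul h2).mul (by fun_prop)).ennreal_ofReal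

lemma B_meas (n : ℕ) (δ q : ℝ) (g h : V n → ℝ) (hg : Measurable g) (hh : Measurable h) :
    Measurable (fun x : V n × V n × Metric.sphere (0 : V n) 1 =>
      ENNReal.ofReal (Mt δ q (x.2.2 : V n) (x.1 - x.2.1) * |g x.2.1| *
        h (vprime x.1 x.2.1 (x.2.2 : V n)) ^ 2)) := by
  have h1 : Measurable (fun x : V n × V n × Metric.sphere (0 : V n) 1 =>
      Mt δ q (x.2.2 : V n) (x.1 - x.2.1)) :=
    Measurable.comp (g := fun x : V n × V n => Mt δ q x.1 x.2)
      (f := fun x : V n × V n × Metric.sphere (0 : V n) 1 => ((x.2.2 : V n), x.1 - x.2.1))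
      (Mt_meas δ q) (Measurable.prodMk (by fun_prop) (by fun_prop))
  have h2 : Measurable (fun x : V n × V n × Metric.sphere (0 : V n) 1 => |g x.2.1|) := by
    simp_rw [← Real.norm_eq_abs]; fun_prop
  exact ((h1.mul h2).mul ((hh.comp (vprime_meas n)).pow_const 2)).ennreal_ofReal

lemma hinner (n : ℕ) (δ q : ℝ) (g h : V n → ℝ) (vs : V n) (σ : V n) (hσ : ‖σ‖ = 1) :
    ∫⁻ v : V n, ENNReal.ofReal (Mt δ q σ (v - vs) * |g vs| * h (vprime v vs σ) ^ 2)
    ≤ 2 ^ n * ∫⁻ v : V n, ENNReal.ofReal (Mk δ q σ (v - vs) * |g vs| * h v ^ 2) := by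
  let G : V n → ℝ≥0∞ := fun w => ENNReal.ofReal (Mk δ q σ w * |g vs| * h (vs + w) ^ 2)
  have e1 : ∀ v : V n, ENNReal.ofReal
      (Mt δ q σ (v - vs) * |g vs| * h (vprime v vs σ) ^ 2) =
      (cone σ).indicator (fun u => G (Tm σ u)) (v - vs) := by
    intro v
    by_cases hc : v - vs ∈ cone σ
    · simp only [Set.indicator_of_mem hc, G, Mt, if_pos hc, vprime_eq]
    · simp only [Set.indicator_of_notMem hc, Mt, if_neg hc, zero_mul, ENNReal.ofReal_zero]
  have e2 : ∀ v : V n, ENNReal.ofReal (Mk δ q σ (v - vs) * |g vs| * h v ^ 2) = G (v - vs) := by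
    intro v
    simp only [G, add_sub_cancel]
  rw [lintegral_congr e1, lintegral_congr e2,
    lintegral_sub_right_eq_self (fun u => (cone σ).indicator (fun u => G (Tm σ u)) u) vs,
    lintegral_sub_right_eq_self G vs]
  exact chvar σ hσ G

lemma hpart_aux (n : ℕ) (F1 F2 : V n → V n → Metric.sphere (0 : V n) 1 → ℝ≥0∞)
    (h1 : Measurable (fun x : V n × V n × Metric.sphere (0 : V n) 1 => F1 x.1 x.2.1 x.2.2))
    (h2 : Measurable (fun x : V n × V n × Metric.sphere (0 : V n) 1 => F2 x.1 x.2.1 x.2.2))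
    (h : ∀ vs σ, ∫⁻ v, F1 v vs σ ≤ 2 ^ n * ∫⁻ v, F2 v vs σ) :
    ∫⁻ v : V n, ∫⁻ vs : V n, ∫⁻ σ, F1 v vs σ ∂(sphMeas n) ≤
    2 ^ n * ∫⁻ v : V n, ∫⁻ vs : V n, ∫⁻ σ, F2 v vs σ ∂(sphMeas n) := by
  have ht : (2:ℝ≥0∞) ^ n ≠ ⊤ := by finiteness
  rw [swap3 n F1 h1, swap3 n F2 h2, ← lintegral_const_mul' _ _ ht]
  refine lintegral_mono fun vs => ?_
  rw [← lintegral_const_mul' _ _ ht]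
  exact lintegral_mono fun σ => h vs σ

lemma hpart (n : ℕ) (δ q : ℝ) (g h : V n → ℝ) (hg : Measurable g) (hh : Measurable h) :
    ∫⁻ v : V n, ∫⁻ vs : V n, ∫⁻ σ : Metric.sphere (0 : V n) 1,
      ENNReal.ofReal (Mt δ q (σ : V n) (v - vs) * |g vs| * h (vprime v vs σ) ^ 2) ∂(sphMeas n)
    ≤ 2 ^ n * ∫⁻ v : V n, ∫⁻ vs : V n, ∫⁻ σ : Metric.sphere (0 : V n) 1,
      ENNReal.ofReal (Mk δ q (σ : V n) (v - vs) * |g vs| * h v ^ 2) ∂(sphMeas n) :=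
  hpart_aux n
    (fun v vs σ => ENNReal.ofReal (Mt δ q (σ : V n) (v - vs) * |g vs| * h (vprime v vs σ) ^ 2))
    (fun v vs σ => ENNReal.ofReal (Mk δ q (σ : V n) (v - vs) * |g vs| * h v ^ 2))
    (B_meas n δ q g h hg hh) (A_meas n δ q g h hg hh)
    (fun vs σ => hinner n δ q g h vs σ (norm_eq_of_mem_sphere σ))

lemma cs3 (n : ℕ) (A B : V n → V n → Metric.sphere (0 : V n) 1 → ℝ≥0∞)
    (hA : Measurable (fun x : V n × V n × Metric.sphere (0 : V n) 1 => A x.1 x.2.1 x.2.2))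
    (hB : Measurable (fun x : V n × V n × Metric.sphere (0 : V n) 1 => B x.1 x.2.1 x.2.2)) :
    ∫⁻ v : V n, ∫⁻ vs : V n, ∫⁻ σ, A v vs σ ^ (2⁻¹ : ℝ) * B v vs σ ^ (2⁻¹ : ℝ) ∂(sphMeas n) ≤
    (∫⁻ v : V n, ∫⁻ vs : V n, ∫⁻ σ, A v vs σ ∂(sphMeas n)) ^ (2⁻¹ : ℝ) *
    (∫⁻ v : V n, ∫⁻ vs : V n, ∫⁻ σ, B v vs σ ∂(sphMeas n)) ^ (2⁻¹ : ℝ) := by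
  have key : ∀ F : V n → V n → Metric.sphere (0 : V n) 1 → ℝ≥0∞,
      Measurable (fun x : V n × V n × Metric.sphere (0 : V n) 1 => F x.1 x.2.1 x.2.2) →
      ∫⁻ v : V n, ∫⁻ vs : V n, ∫⁻ σ, F v vs σ ∂(sphMeas n) =
      ∫⁻ x, F x.1 x.2.1 x.2.2 ∂((volume : Measure (V n)).prod
        ((volume : Measure (V n)).prod (sphMeas n))) := by
    intro F hF
    rw [lintegral_prod (fun x : V n × V n × Metric.sphere (0 : V n) 1 => F x.1 x.2.1 x.2.2)
      hF.aemeasurable]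
    apply lintegral_congr
    intro v
    rw [lintegral_prod (fun y : V n × Metric.sphere (0 : V n) 1 => F v y.1 y.2)]
    exact (hF.comp (measurable_const.prodMk measurable_id)).aemeasurable
  rw [key A hA, key B hB, key (fun v vs σ => A v vs σ ^ (2⁻¹ : ℝ) * B v vs σ ^ (2⁻¹ : ℝ))
    ((hA.pow_const _).mul (hB.pow_const _))]
  have h := ENNReal.lintegral_mul_le_Lp_mul_Lq ((volume : Measure (V n)).prod
        ((volume : Measure (V n)).prod (sphMeas n))) Real.HolderConjugate.two_two
        (hA.pow_const (2⁻¹ : ℝ)).aemeasurable (hB.pow_const (2⁻¹ : ℝ)).aemeasurable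
  simp only [← ENNReal.rpow_mul] at h
  norm_num at h
  norm_num
  exact h

lemma amgm_pt (X c M1 M2 G F H : ℝ) (hc : 0 ≤ c) (hM1 : 0 ≤ M1) (hM2 : 0 ≤ M2) (hX : 0 ≤ X)
    (h1 : X ≤ c * M1) (h2 : X ≤ c * M2) :
    ENNReal.ofReal (X * |G| * |F * H|) ≤ ENNReal.ofReal c *
      (ENNReal.ofReal (M1 * |G| * F ^ 2) ^ (2⁻¹ : ℝ) *
        ENNReal.ofReal (M2 * |G| * H ^ 2) ^ (2⁻¹ : ℝ)) := by
  rw [ENNReal.ofReal_rpow_of_nonneg (by positivity) (by norm_num),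
    ENNReal.ofReal_rpow_of_nonneg (by positivity) (by norm_num),
    ← ENNReal.ofReal_mul (by positivity), ← ENNReal.ofReal_mul (by positivity)]
  apply ENNReal.ofReal_le_ofReal
  rw [← Real.mul_rpow (by positivity) (by positivity)]
  rw [show (2⁻¹ : ℝ) = 1 / 2 by norm_num, ← Real.sqrt_eq_rpow]
  have h3 : X ≤ c * Real.sqrt (M1 * M2) := by
    rw [← Real.sqrt_sq hc, ← Real.sqrt_mul (by positivity)]
    apply Real.le_sqrt_of_sq_le
    nlinarith [mul_le_mul h1 h2 hX (by positivity)]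
  have h4 : M1 * |G| * F ^ 2 * (M2 * |G| * H ^ 2) = M1 * M2 * (|G| * |F * H|) ^ 2 := by
    rw [mul_pow, sq_abs (F * H)]; ring
  rw [h4, Real.sqrt_mul (by positivity), Real.sqrt_sq (by positivity)]
  calc X * |G| * |F * H| ≤ c * Real.sqrt (M1 * M2) * |G| * |F * H| := by gcongr
    _ = _ := by ring

/-- Proposition 2.4 (trivial estimate for the gain piece `D^k_+`). -/
theorem trivial_estimate_gain
    (n : ℕ) (hn : 2 ≤ n) (s γ CΦ cb : ℝ)
    (hs : s ∈ Set.Ioo (0:ℝ) 1) (hγ : -(n:ℝ) < γ) (hCΦ : 0 < CΦ) (hcb : 0 < cb) :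
    ∃ C : ℝ, 0 < C ∧
      ∀ b : ℝ → ℝ, KernelAssumptions n s cb b →
      ∀ g : V n → ℝ, Measurable g →
      ∀ Cg : ℝ, 0 < Cg → AssumptionU s γ Cg g →
      ∀ f h : V n → ℝ, Measurable f → Measurable h →
      ∀ k : ℤ, ∀ χ : ℝ → ℝ, Measurable χ → (∀ t, χ t ∈ Set.Icc (0:ℝ) 1) →
        (∀ t : ℝ, t ∉ Set.Icc ((2:ℝ) ^ (-k - 1)) ((2:ℝ) ^ (-k)) → χ t = 0) →
        (∫⁻ v : V n, ∫⁻ vs : V n, ∫⁻ σ : Metric.sphere (0 : V n) 1,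
            ENNReal.ofReal (Bker CΦ γ b v vs σ * χ ‖vprime v vs σ - v‖ *
              |g vs| * |f v * h (vprime v vs σ)|) ∂(sphMeas n)) ≤
          ENNReal.ofReal (C * Cg * (2:ℝ) ^ (2 * s * (k:ℝ))) *
            L2e (γ + 2 * s) f ^ (2⁻¹ : ℝ) * L2e (γ + 2 * s) h ^ (2⁻¹ : ℝ) := by
  have hpi := Real.pi_pos
  have hn0 : (0:ℝ) < n := by exact_mod_cast (by omega : 0 < n)
  have hK2 : 0 < K2 n s γ CΦ cb := by unfold K2; positivity
  have hCn : 0 < Cn n := by unfold Cn; positivity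
  refine ⟨K2 n s γ CΦ cb * Cn n * 2 ^ n, by positivity, ?_⟩
  intro b hb g hg Cg hCg hU f h hf hh k χ _ hχ hχ0
  set δ : ℝ := (2:ℝ) ^ (-k) with hδdef
  have hδ : 0 < δ := by positivity
  have hδ2 : (2:ℝ) ^ (-k - 1) = δ / 2 := by
    rw [zpow_sub₀ (by norm_num), zpow_one]
  rw [hδ2] at hχ0
  set p : ℝ := (n:ℝ) - 1 + 2 * s with hp
  have hδp : δ ^ (-p) * δ ^ ((n:ℝ) - 1) = (2:ℝ) ^ (2 * s * (k:ℝ)) := by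
    rw [← Real.rpow_add hδ, hδdef, ← Real.rpow_intCast, ← Real.rpow_mul (by norm_num)]
    congr 1
    push_cast
    rw [hp]; ring
  set c : ℝ := K2 n s γ CΦ cb * δ ^ (-p) with hc
  have hc0 : 0 ≤ c := by positivity
  set D : ℝ≥0∞ := ENNReal.ofReal (2 ^ n * (Cn n * δ ^ ((n:ℝ) - 1) * Cg)) with hD
  have h2n : (2:ℝ≥0∞) ^ n = ENNReal.ofReal (2 ^ n) := by
    rw [ENNReal.ofReal_pow (by norm_num)]; simp
  have hA : ∫⁻ v : V n, ∫⁻ vs : V n, ∫⁻ σ : Metric.sphere (0 : V n) 1,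
      ENNReal.ofReal (Mk δ (γ + p) (σ : V n) (v - vs) * |g vs| * f v ^ 2) ∂(sphMeas n)
      ≤ D * L2e (γ + 2 * s) f := by
    refine (fpart n hn s γ hs.1 δ hδ g Cg hCg hU f).trans ?_
    gcongr
    apply ENNReal.ofReal_le_ofReal
    exact le_mul_of_one_le_left (by positivity) (one_le_pow₀ (by norm_num))
  have hB : ∫⁻ v : V n, ∫⁻ vs : V n, ∫⁻ σ : Metric.sphere (0 : V n) 1,
      ENNReal.ofReal (Mt δ (γ + p) (σ : V n) (v - vs) * |g vs| * h (vprime v vs σ) ^ 2) ∂(sphMeas n)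
      ≤ D * L2e (γ + 2 * s) h := by
    refine (hpart n δ (γ + p) g h hg hh).trans ?_
    rw [hD, ENNReal.ofReal_mul (by positivity), ← h2n, mul_assoc]
    gcongr
    exact fpart n hn s γ hs.1 δ hδ g Cg hCg hU h
  calc _ ≤ ∫⁻ v : V n, ∫⁻ vs : V n, ∫⁻ σ : Metric.sphere (0 : V n) 1, ENNReal.ofReal c *
        (ENNReal.ofReal (Mk δ (γ + p) (σ : V n) (v - vs) * |g vs| * f v ^ 2) ^ (2⁻¹ : ℝ) *
        ENNReal.ofReal (Mt δ (γ + p) (σ : V n) (v - vs) * |g vs| * h (vprime v vs σ) ^ 2) ^ (2⁻¹ : ℝ))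
          ∂(sphMeas n) := by
        refine lintegral_mono fun v => lintegral_mono fun vs => lintegral_mono fun σ => ?_
        have hpt := pointwise n hn s γ CΦ cb hs.1 hCΦ hcb b hb δ hδ χ hχ hχ0 v vs σ (by simp)
        refine amgm_pt _ c _ _ (g vs) (f v) (h (vprime v vs σ)) hc0 (Mk_nonneg _ _ _ _)
          (Mt_nonneg _ _ _ _) ?_ hpt.1 hpt.2
        refine mul_nonneg ?_ (hχ _).1
        unfold Bker
        have := hb.2.1 ⟪‖v - vs‖⁻¹ • (v - vs), (σ : V n)⟫
        positivity
    _ = ENNReal.ofReal c * ∫⁻ v : V n, ∫⁻ vs : V n, ∫⁻ σ : Metric.sphere (0 : V n) 1,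
        (ENNReal.ofReal (Mk δ (γ + p) (σ : V n) (v - vs) * |g vs| * f v ^ 2) ^ (2⁻¹ : ℝ) *
        ENNReal.ofReal (Mt δ (γ + p) (σ : V n) (v - vs) * |g vs| * h (vprime v vs σ) ^ 2) ^ (2⁻¹ : ℝ))
          ∂(sphMeas n) := by
        simp_rw [lintegral_const_mul' (ENNReal.ofReal c) _ ENNReal.ofReal_ne_top]
    _ ≤ ENNReal.ofReal c * ((D * L2e (γ + 2 * s) f) ^ (2⁻¹ : ℝ) *
          (D * L2e (γ + 2 * s) h) ^ (2⁻¹ : ℝ)) := by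
        gcongr
        refine (cs3 n
          (fun v vs σ => ENNReal.ofReal (Mk δ (γ + p) (σ : V n) (v - vs) * |g vs| * f v ^ 2))
          (fun v vs σ => ENNReal.ofReal
            (Mt δ (γ + p) (σ : V n) (v - vs) * |g vs| * h (vprime v vs σ) ^ 2))
          (A_meas n δ _ g f hg hf) (B_meas n δ _ g h hg hh)).trans ?_
        gcongr
    _ = ENNReal.ofReal c * D * L2e (γ + 2 * s) f ^ (2⁻¹ : ℝ) * L2e (γ + 2 * s) h ^ (2⁻¹ : ℝ) := by
        rw [ENNReal.mul_rpow_of_nonneg _ _ (by norm_num), ENNReal.mul_rpow_of_nonneg _ _ (by norm_num)]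
        have hDD : D ^ (2⁻¹ : ℝ) * D ^ (2⁻¹ : ℝ) = D := by
          rw [← ENNReal.rpow_add_of_nonneg _ _ (by norm_num) (by norm_num)]
          norm_num
        nth_rewrite 3 [← hDD]
        ring
    _ = _ := by
        rw [hD, ← ENNReal.ofReal_mul hc0]
        congr 3
        rw [← hδp, hc]
        ring
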